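/- arXiv:hep-th/0602256 — 2 statements merged into one kernel-verified Lean document; each statement's English description precedes it below -/
import Mathlib

section
/- Every C*-algebra A admits an isometric star-algebra homomorphism into the algebra of bounded linear operators on some complex Hilbert space; that is, there exist a complex Hilbert space H and a star-algebra homomorphism π : A → L(H) with ‖π(a)‖ = ‖a‖ for all a ∈ A. -/
open scoped ComplexOrder InnerProductSpace ENNReal

section DirectSum

variable {ι : Type*} {G : ι → Type*} [∀ i, NormedAddCommGroup (G i)]
  [∀ i, InnerProductSpace ℂ (G i)]

/-- The diagonal operator on a Hilbert sum given by a uniformly bounded family of operators. -/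
noncomputable def lpDiagonal (T : ∀ i, G i →L[ℂ] G i) (C : ℝ) (hT : ∀ i, ‖T i‖ ≤ C) :
    lp G 2 →L[ℂ] lp G 2 :=
  have hle (x : lp G 2) (i : ι) : ‖T i (x i)‖ ≤ ‖((C : ℂ) • x) i‖ := by
    have hC : ‖T i‖ ≤ ‖(C : ℂ)‖ := (hT i).trans (by simpa using le_abs_self C)
    rw [lp.coeFn_smul, Pi.smul_apply, norm_smul]
    exact (T i).le_of_opNorm_le hC (x i)
  LinearMap.mkContinuous
    { toFun x := ⟨fun i ↦ T i (x i), (lp.memℓp ((C : ℂ) • x)).mono' (hle x)⟩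
      map_add' x y := by ext i; exact map_add (T i) (x i) (y i)
      map_smul' c x := by ext i; exact map_smul (T i) c (x i) } ‖(C : ℂ)‖
    fun x ↦ (lp.norm_mono two_ne_zero (hle x)).trans (norm_smul_le _ _)

@[simp]
lemma lpDiagonal_apply (T : ∀ i, G i →L[ℂ] G i) (C : ℝ) (hT : ∀ i, ‖T i‖ ≤ C) (x : lp G 2)
    (i : ι) : lpDiagonal T C hT x i = T i (x i) := rfl

variable [∀ i, CompleteSpace (G i)] {A : Type*} [CStarAlgebra A]

/-- The Hilbert sum of a family of representations of a C⋆-algebra. -/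
noncomputable def StarAlgHom.hilbertSum (π : ∀ i, A →⋆ₐ[ℂ] (G i →L[ℂ] G i)) :
    A →⋆ₐ[ℂ] (lp G 2 →L[ℂ] lp G 2) where
  toFun a := lpDiagonal (fun i ↦ π i a) ‖a‖ fun i ↦ NonUnitalStarAlgHom.norm_apply_le (π i) a
  map_one' := by ext x i; simp
  map_mul' a b := by ext x i; simp
  map_zero' := by ext x i; simp
  map_add' a b := by ext x i; simp
  commutes' r := by ext x i; simp [Algebra.algebraMap_eq_smul_one]
  map_star' a := by
    refine (ContinuousLinearMap.eq_adjoint_iff _ _).mpr fun x y ↦ ?_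
    simp [lp.inner_eq_tsum, map_star, ContinuousLinearMap.star_eq_adjoint,
      ContinuousLinearMap.adjoint_inner_left]

@[simp]
lemma StarAlgHom.hilbertSum_apply (π : ∀ i, A →⋆ₐ[ℂ] (G i →L[ℂ] G i)) (a : A) (x : lp G 2)
    (i : ι) : StarAlgHom.hilbertSum π a x i = π i a (x i) := rfl

lemma StarAlgHom.hilbertSum_injective (π : ∀ i, A →⋆ₐ[ℂ] (G i →L[ℂ] G i))
    (hπ : ∀ a, (∀ i, π i a = 0) → a = 0) : Function.Injective (StarAlgHom.hilbertSum π) := by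
  classical
  refine (injective_iff_map_eq_zero _).mpr fun a ha ↦ hπ a fun i ↦ ?_
  ext v
  have h := congr($ha (lp.single 2 i v) i)
  simpa using h

end DirectSum

section PositiveFunctional

variable {A : Type*} [CStarAlgebra A] [PartialOrder A] [StarOrderedRing A]

/-- Positive functionals on a C⋆-algebra detect nonzero elements. -/
lemma PositiveLinearMap.exists_star_mul_self_ne_zero {a : A} (ha : a ≠ 0) :
    ∃ f : A →ₚ[ℂ] ℂ, f (star a * a) ≠ 0 := by
  let K : ProperCone ℝ A :=
    { carrier := {x | 0 ≤ x}
      add_mem' := fun hx hy ↦ add_nonneg hx hy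
      zero_mem' := le_refl (0 : A)
      smul_mem' := fun c x hx ↦ smul_nonneg c.2 hx
      isClosed' := CStarAlgebra.isClosed_nonneg }
  have hK : -(star a * a) ∉ K := fun h ↦ ha <| by
    have h' : 0 ≤ -(star a * a) := h
    exact (CStarRing.star_mul_self_eq_zero_iff a).mp
      (le_antisymm (neg_nonneg.mp h') (star_mul_self_nonneg a))
  obtain ⟨f, hf, hfa⟩ := K.hyperplane_separation_point hK
  let g : Module.Dual ℝ A :=
    f.toLinearMap ∘ₗ (selfAdjoint.submodule ℝ A).subtype ∘ₗ realPart
  have hg {x : A} (hx : IsSelfAdjoint x) : g.extendRCLike (𝕜 := ℂ) x = f x := by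
    have h1 : g x = f x := congr(f $(hx.coe_realPart))
    have h2 : g ((Complex.I) • x) = 0 := by
      change f (realPart (Complex.I • x) : A) = 0
      simp [realPart_I_smul, hx.imaginaryPart]
    simp [Module.Dual.extendRCLike_apply, h1, h2]
  refine ⟨.mk₀ (g.extendRCLike (𝕜 := ℂ)) fun x hx ↦ ?_, ?_⟩
  · rw [hg hx.isSelfAdjoint]
    exact_mod_cast hf x hx
  · change g.extendRCLike (𝕜 := ℂ) (star a * a) ≠ 0
    rw [hg (.star_mul_self a)]
    rw [map_neg] at hfa
    exact_mod_cast (neg_lt_zero.mp hfa).ne'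

lemma PositiveLinearMap.apply_star_mul_self_eq_zero (f : A →ₚ[ℂ] ℂ) {a : A}
    (ha : f.gnsStarAlgHom a = 0) : f (star a * a) = 0 := by
  have h : f.gnsNonUnitalStarAlgHom a (f.toPreGNS 1 : f.GNS) = 0 := congr($ha (f.toPreGNS 1))
  rw [gnsNonUnitalStarAlgHom_apply_coe, ← norm_eq_zero, UniformSpace.Completion.norm_coe] at h
  have h' := f.preGNS_norm_sq (f.leftMulMapPreGNS a (f.toPreGNS 1))
  rw [h] at h'
  simpa using h'.symm

end PositiveFunctional

/-- **Second Gel'fand–Naĭmark theorem.** Every C*-algebra admits an isometric star-algebra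
homomorphism into the bounded linear operators on some complex Hilbert space. -/
theorem gelfand_naimark_two (A : Type u) [NormedRing A] [NormedAlgebra ℂ A]
    [CompleteSpace A] [StarRing A] [CStarRing A] [StarModule ℂ A] :
    ∃ (H : Type u) (_ : NormedAddCommGroup H) (_ : InnerProductSpace ℂ H)
      (_ : CompleteSpace H) (π : A →⋆ₐ[ℂ] (H →L[ℂ] H)),
      ∀ a : A, ‖π a‖ = ‖a‖ := by
  let _ : CStarAlgebra A := {}
  let _ := CStarAlgebra.spectralOrder A
  have _ := CStarAlgebra.spectralOrderedRing A
  refine ⟨lp (fun f : A →ₚ[ℂ] ℂ ↦ f.GNS) 2, inferInstance, inferInstance, inferInstance,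
    StarAlgHom.hilbertSum fun f ↦ f.gnsStarAlgHom,
    NonUnitalStarAlgHom.norm_map _ (StarAlgHom.hilbertSum_injective _ fun a ha ↦ ?_)⟩
  by_contra h
  obtain ⟨f, hf⟩ := PositiveLinearMap.exists_star_mul_self_ne_zero h
  exact hf (f.apply_star_mul_self_eq_zero (ha f))
end

section
/- Let L¹(ℝ) denote the complex Lebesgue-integrable functions on ℝ, regarded as a commutative Banach algebra under convolution. Every nonzero continuous multiplicative linear functional (character) φ on this convolution algebra is of the form φ(f) = ∫_ℝ e^{-itx} f(x) dx for a unique t ∈ ℝ; consequently the Gelfand transform of f is its Fourier transform. -/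
open MeasureTheory Convolution

/-- A bounded continuous multiplicative function `χ : ℝ → ℂ` with `χ 0 = 1` is of the form
`a ↦ e^{-ita}`. -/
theorem exists_eq_exp_of_bounded_continuous_map_add {χ : ℝ → ℂ} (hc : Continuous χ)
    (h0 : χ 0 = 1) (hadd : ∀ a b, χ (a + b) = χ a * χ b) {M : ℝ} (hM : ∀ a, ‖χ a‖ ≤ M) :
    ∃ t : ℝ, ∀ a : ℝ, χ a = Complex.exp (-(Complex.I * t * a)) := by
  have hF : ∀ a : ℝ, HasDerivAt (fun u ↦ ∫ x in (0 : ℝ)..u, χ x) (χ a) a := fun a ↦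
    intervalIntegral.integral_hasDerivAt_right (hc.intervalIntegrable _ _)
      (hc.stronglyMeasurableAtFilter _ _) hc.continuousAt
  obtain ⟨u, hu⟩ : ∃ u : ℝ, (∫ x in (0 : ℝ)..u, χ x) ≠ 0 := by
    by_contra! h
    have h1 := hF 0
    simp only [h, h0] at h1
    exact zero_ne_one ((hasDerivAt_const (0 : ℝ) (0 : ℂ)).unique h1)
  have hχ : ∀ a : ℝ, χ a =
      ((∫ x in (0 : ℝ)..(a + u), χ x) - ∫ x in (0 : ℝ)..a, χ x) / ∫ x in (0 : ℝ)..u, χ x := by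
    intro a
    rw [eq_div_iff hu, ← intervalIntegral.integral_const_mul]
    simp_rw [← hadd]
    rw [intervalIntegral.integral_comp_add_left (fun x ↦ χ x) a, add_zero,
      intervalIntegral.integral_interval_sub_left (hc.intervalIntegrable _ _)
        (hc.intervalIntegrable _ _)]
  obtain ⟨c, hc0⟩ : ∃ c, HasDerivAt χ c 0 := by
    have h1 := (((hF (0 + u)).comp_add_const 0 u).sub (hF 0)).div_const
      (∫ x in (0 : ℝ)..u, χ x)
    exact ⟨_, h1.congr_of_eventuallyEq (Filter.Eventually.of_forall hχ)⟩
  have hd : ∀ a, HasDerivAt χ (χ a * c) a := by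
    intro a
    have h1 : HasDerivAt (fun x ↦ χ a * χ (x - a)) (χ a * c) a :=
      (HasDerivAt.comp_sub_const a a (by rwa [sub_self])).const_mul _
    refine h1.congr_of_eventuallyEq (Filter.Eventually.of_forall fun x ↦ ?_)
    simp only [← hadd, add_sub_cancel]
  have hexp : ∀ a : ℝ, χ a = Complex.exp (c * a) := by
    have hg : ∀ a : ℝ, HasDerivAt (fun x : ℝ ↦ χ x * Complex.exp (-(c * x))) 0 a := by
      intro a
      have h2 : HasDerivAt (fun x : ℝ ↦ -(c * (x : ℂ))) (-(c * 1)) a :=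
        ((Complex.ofRealCLM.hasDerivAt (x := a)).const_mul c).neg
      convert! (hd a).mul h2.cexp using 1
      ring
    intro a
    have h3 := is_const_of_deriv_eq_zero (fun x ↦ (hg x).differentiableAt)
      (fun x ↦ (hg x).deriv) a 0
    simp only [h0, Complex.ofReal_zero, mul_zero, neg_zero, Complex.exp_zero, mul_one] at h3
    rw [Complex.exp_neg] at h3
    exact (mul_inv_eq_one₀ (Complex.exp_ne_zero _)).1 h3
  have hre : c.re = 0 := by
    by_contra hne
    have h4 := hM (M / c.re)
    rw [hexp, Complex.norm_exp] at h4
    have h5 : (c * ((M / c.re : ℝ) : ℂ)).re = M := by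
      rw [Complex.re_mul_ofReal]; field_simp
    rw [h5] at h4
    linarith [Real.add_one_le_exp M]
  refine ⟨-c.im, fun a ↦ ?_⟩
  rw [hexp]
  congr 1
  apply Complex.ext <;> simp [hre]

section Translation

variable {E : Type*} [NormedAddCommGroup E]

theorem norm_toL1_comp_sub_right {f : ℝ → E} (hf : Integrable f volume) (a : ℝ) :
    ‖(hf.comp_sub_right a).toL1 (fun x ↦ f (x - a))‖ = ‖hf.toL1 f‖ := by
  simp only [Integrable.norm_toL1_eq_lintegral_enorm]
  rw [lintegral_sub_right_eq_self (fun x ↦ ‖f x‖ₑ) a]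

/-- Translation is continuous in `L¹(ℝ)`. -/
theorem continuous_toL1_comp_sub_right {f : ℝ → E} (hf : Integrable f volume) :
    Continuous fun a : ℝ ↦ (hf.comp_sub_right a).toL1 (fun x ↦ f (x - a)) := by
  have hg : Continuous fun a : ℝ ↦ (⟨fun x ↦ x - a, by fun_prop⟩ : C(ℝ, ℝ)) :=
    ContinuousMap.continuous_of_continuous_uncurry _ (by
      simp only [Function.uncurry_def, ContinuousMap.coe_mk]; fun_prop)
  exact (continuous_const (y := hf.toL1 f)).compMeasurePreservingLp hg
    (fun a ↦ measurePreserving_sub_right volume a) ENNReal.one_ne_top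

end Translation

theorem integrable_smul_toL1_comp_sub_right {f g : ℝ → ℂ} (hf : Integrable f volume)
    (hg : Integrable g volume) :
    Integrable fun y ↦ f y • (hg.comp_sub_right y).toL1 (fun x ↦ g (x - y)) := by
  refine hf.smul_bdd ‖hg.toL1 g‖
    (continuous_toL1_comp_sub_right hg).aestronglyMeasurable ?_
  exact Filter.Eventually.of_forall fun y ↦ (norm_toL1_comp_sub_right hg y).le

/-- The convolution of two integrable functions is the `L¹`-valued integral of translates. -/
theorem toL1_convolution_eq_integral {f g : ℝ → ℂ} (hf : Integrable f volume)
    (hg : Integrable g volume) :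
    (hf.integrable_convolution (ContinuousLinearMap.mul ℂ ℂ) hg).toL1
        (f ⋆[ContinuousLinearMap.mul ℂ ℂ] g) =
      ∫ y, f y • (hg.comp_sub_right y).toL1 (fun x ↦ g (x - y)) := by
  have hint := integrable_smul_toL1_comp_sub_right hf hg
  set H := ∫ y, f y • (hg.comp_sub_right y).toL1 (fun x ↦ g (x - y)) with hH
  have hconv := hf.integrable_convolution (ContinuousLinearMap.mul ℂ ℂ) hg
  rw [← Integrable.toL1_coeFn H (L1.integrable_coeFn H), Integrable.toL1_eq_toL1_iff]
  refine Integrable.ae_eq_of_forall_setIntegral_eq _ _ hconv (L1.integrable_coeFn H)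
    fun s _ _ ↦ ?_
  let J : Lp ℂ 1 (volume : Measure ℝ) →L[ℂ] ℂ :=
    (L1.integralCLM' ℂ).comp (LpToLpRestrictCLM ℝ ℂ ℂ volume 1 s)
  have hJ : ∀ F, J F = ∫ x in s, F x := fun F ↦ by
    change L1.integralCLM' ℂ (LpToLpRestrictCLM ℝ ℂ ℂ volume 1 s F) = _
    rw [← L1.integral_eq', L1.integral_eq_integral]
    exact integral_congr_ae (LpToLpRestrictCLM_coeFn ℂ s F)
  rw [← hJ, hH, ← ContinuousLinearMap.integral_comp_comm J hint]
  have h1 : ∀ y, J (f y • (hg.comp_sub_right y).toL1 (fun x ↦ g (x - y))) =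
      ∫ x in s, f y * g (x - y) := fun y ↦ by
    rw [map_smul, hJ, integral_const_mul, smul_eq_mul,
      integral_congr_ae (ae_restrict_of_ae (hg.comp_sub_right y).coeFn_toL1)]
  simp_rw [h1]
  have h2 : Integrable (fun p : ℝ × ℝ ↦ f p.2 * g (p.1 - p.2)) (volume.prod volume) :=
    hf.convolution_integrand (ContinuousLinearMap.mul ℂ ℂ) hg
  have h3 : Integrable (Function.uncurry fun x y ↦ f y * g (x - y))
      ((volume.restrict s).prod volume) := by
    refine h2.mono_measure ?_
    nth_rewrite 2 [← Measure.restrict_univ (μ := (volume : Measure ℝ))]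
    rw [Measure.prod_restrict]
    exact Measure.restrict_le_self
  exact integral_integral_swap h3

theorem integral_exp_mul_comp_sub_right (t a : ℝ) (f : ℝ → ℂ) :
    ∫ x : ℝ, Complex.exp (-(Complex.I * t * x)) * f (x - a) =
      Complex.exp (-(Complex.I * t * a)) * ∫ x : ℝ, Complex.exp (-(Complex.I * t * x)) * f x := by
  rw [← integral_const_mul, ← integral_add_right_eq_self _ a]
  refine integral_congr_ae (Filter.Eventually.of_forall fun x ↦ ?_)
  simp only [add_sub_cancel_right, Complex.ofReal_add]
  rw [← mul_assoc, ← Complex.exp_add]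
  congr 2
  ring

theorem eq_of_forall_exp_mul_I_eq {s t : ℝ}
    (h : ∀ a : ℝ, Complex.exp (-(Complex.I * s * a)) = Complex.exp (-(Complex.I * t * a))) :
    s = t := by
  by_contra hne
  have hst : (s : ℂ) - t ≠ 0 := by exact_mod_cast sub_ne_zero.2 hne
  have h1 := h (Real.pi / (s - t))
  have h2 : -(Complex.I * t * ((Real.pi / (s - t) : ℝ) : ℂ)) =
      -(Complex.I * s * ((Real.pi / (s - t) : ℝ) : ℂ)) + Real.pi * Complex.I := by
    push_cast
    field_simp
    ring
  rw [h2, Complex.exp_add, Complex.exp_pi_mul_I, mul_neg_one, self_eq_neg] at h1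
  exact Complex.exp_ne_zero _ h1

/-- Every nonzero continuous multiplicative linear functional (character) on the convolution
Banach algebra `L¹(ℝ)` is of the form `f ↦ ∫ e^{-itx} f(x) dx` for a unique `t ∈ ℝ`;
i.e. the Gelfand transform of `f` is its Fourier transform. -/
theorem l1_convolution_character_eq_fourier
    (φ : Lp ℂ 1 (volume : Measure ℝ) →L[ℂ] ℂ) (hφ : φ ≠ 0)
    (hmul : ∀ (f g : ℝ → ℂ) (hf : Integrable f volume) (hg : Integrable g volume),
      φ ((hf.integrable_convolution (ContinuousLinearMap.mul ℂ ℂ) hg).toL1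
          (f ⋆[ContinuousLinearMap.mul ℂ ℂ] g)) =
        φ (hf.toL1 f) * φ (hg.toL1 g)) :
    ∃! t : ℝ, ∀ (f : ℝ → ℂ) (hf : Integrable f volume),
      φ (hf.toL1 f) = ∫ x : ℝ, Complex.exp (-(Complex.I * t * x)) * f x := by
  have hext : ∀ F : Lp ℂ 1 (volume : Measure ℝ), ∃ (f : ℝ → ℂ) (hf : Integrable f volume),
      hf.toL1 f = F := fun F ↦ ⟨F, L1.integrable_coeFn F, Integrable.toL1_coeFn F _⟩
  obtain ⟨g, hg, hg0⟩ : ∃ (g : ℝ → ℂ) (hg : Integrable g volume), φ (hg.toL1 g) ≠ 0 := by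
    by_contra! h
    refine hφ (ContinuousLinearMap.ext fun F ↦ ?_)
    obtain ⟨f, hf, rfl⟩ := hext F
    exact h f hf
  have hconv : ∀ (f h : ℝ → ℂ) (hf : Integrable f volume) (hh : Integrable h volume) (a : ℝ),
      φ ((hf.comp_sub_right a).toL1 (fun x ↦ f (x - a))) * φ (hh.toL1 h) =
        φ (hf.toL1 f) * φ ((hh.comp_sub_right a).toL1 (fun x ↦ h (x - a))) := by
    intro f h hf hh a
    rw [← hmul, ← hmul]
    congr 2
    ext x
    simp only [convolution_def]
    rw [← integral_add_right_eq_self _ a]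
    simp only [add_sub_cancel_right, sub_sub]
  set χ : ℝ → ℂ := fun a ↦ φ ((hg.comp_sub_right a).toL1 (fun x ↦ g (x - a))) / φ (hg.toL1 g)
    with hχ
  have htrans : ∀ (f : ℝ → ℂ) (hf : Integrable f volume) (a : ℝ),
      φ ((hf.comp_sub_right a).toL1 (fun x ↦ f (x - a))) = χ a * φ (hf.toL1 f) := by
    intro f hf a
    have := hconv f g hf hg a
    simp only [hχ]
    field_simp
    linear_combination this
  have hχ0 : χ 0 = 1 := by simp [hχ, hg0]
  have hχadd : ∀ a b, χ (a + b) = χ a * χ b := by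
    intro a b
    have h1 := htrans _ (hg.comp_sub_right b) a
    simp only [sub_sub, htrans g hg] at h1
    refine mul_right_cancel₀ hg0 ?_
    rw [mul_assoc, ← h1]
  have hχc : Continuous χ :=
    (φ.continuous.comp (continuous_toL1_comp_sub_right hg)).div_const _
  have hχb : ∀ a, ‖χ a‖ ≤ ‖φ‖ * ‖hg.toL1 g‖ / ‖φ (hg.toL1 g)‖ := by
    intro a
    rw [hχ, norm_div, ← norm_toL1_comp_sub_right hg a]
    gcongr
    exact φ.le_opNorm _
  obtain ⟨t, ht⟩ := exists_eq_exp_of_bounded_continuous_map_add hχc hχ0 hχadd hχb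
  refine ⟨t, fun f hf ↦ ?_, fun s hs ↦ eq_of_forall_exp_mul_I_eq fun a ↦ ?_⟩
  · refine mul_right_cancel₀ hg0 ?_
    rw [← hmul f g hf hg, toL1_convolution_eq_integral hf hg,
      ← ContinuousLinearMap.integral_comp_comm φ (integrable_smul_toL1_comp_sub_right hf hg),
      ← integral_mul_const]
    refine integral_congr_ae (Filter.Eventually.of_forall fun y ↦ ?_)
    simp only [map_smul, htrans g hg, ht, smul_eq_mul]
    ring
  · refine mul_right_cancel₀ hg0 ?_
    rw [← ht, ← htrans g hg, hs _ (hg.comp_sub_right a), integral_exp_mul_comp_sub_right, ← hs]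
end
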